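/- Let q be a prime power and let d, e be positive integers with q − 1 = d·e. Let a, b ∈ F_q both be nonzero. (i) For every integer ℓ with 0 ≤ ℓ ≤ e−1, the number of x ∈ F_q satisfying x^{e−ℓ} = a·x + b is at most (ℓ+1)·d. (ii) For every integer m ≥ 1, the number of x ∈ F_q satisfying x^{e+m} = a·x + b is at most m·d. -/

import Mathlib

open Polynomial in
/-- A set of nonzero elements of a finite field whose intersection with each fibre `x ^ e = ζ`
consists of roots of a nonzero polynomial of degree at most `k` has at most `k * d` elements,
where `q - 1 = d * e`. -/
theorem card_subtype_le_mul_of_isRoot {F : Type*} [Field F] [Fintype F] {d e k : ℕ} (hd : 0 < d)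
    (hde : Fintype.card F - 1 = d * e) (p : F → Prop) (hp : ∀ x, p x → x ≠ 0) (P : F → F[X])
    (hP : ∀ ζ, P ζ ≠ 0) (hdeg : ∀ ζ, (P ζ).natDegree ≤ k)
    (hroot : ∀ x, p x → (P (x ^ e)).IsRoot x) :
    Nat.card {x : F // p x} ≤ k * d := by
  classical
  rw [Nat.card_eq_fintype_card, Fintype.card_subtype]
  have hcard : (nthRoots d (1 : F)).toFinset.card ≤ d :=
    (Multiset.toFinset_card_le _).trans (card_nthRoots d 1)
  refine (Finset.card_le_mul_card_image_of_maps_to (f := fun x : F ↦ x ^ e)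
    (t := (nthRoots d (1 : F)).toFinset) ?_ k ?_).trans (Nat.mul_le_mul_left k hcard)
  · intro x hx
    rw [Multiset.mem_toFinset, mem_nthRoots hd, ← pow_mul, mul_comm, ← hde]
    exact FiniteField.pow_card_sub_one_eq_one x (hp x (Finset.mem_filter.mp hx).2)
  · intro ζ _
    refine le_trans (Finset.card_le_card (t := (P ζ).roots.toFinset) ?_)
      ((Multiset.toFinset_card_le _).trans ((card_roots' _).trans (hdeg ζ)))
    intro x hx
    simp only [Finset.mem_filter, Finset.mem_univ, true_and] at hx
    obtain ⟨hx, rfl⟩ := hx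
    rw [Multiset.mem_toFinset, mem_roots (hP _)]
    exact hroot x hx

theorem stmt13 {F : Type*} [Field F] [Fintype F] (d e : ℕ) (hd : 0 < d) (he : 0 < e)
    (hde : Fintype.card F - 1 = d * e) (a b : F) (ha : a ≠ 0) (hb : b ≠ 0) :
    (∀ ℓ : ℕ, ℓ ≤ e - 1 →
      Nat.card {x : F // x ^ (e - ℓ) = a * x + b} ≤ (ℓ + 1) * d) ∧
    (∀ m : ℕ, 1 ≤ m →
      Nat.card {x : F // x ^ (e + m) = a * x + b} ≤ m * d) := by
  open Polynomial in
  have hne : ∀ n : ℕ, n ≠ 0 → ∀ x : F, x ^ n = a * x + b → x ≠ 0 := by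
    rintro n hn x hx rfl
    rw [zero_pow hn, mul_zero, zero_add] at hx
    exact hb hx.symm
  refine ⟨fun ℓ hℓ ↦ ?_, fun m hm ↦ ?_⟩
  · refine card_subtype_le_mul_of_isRoot hd hde _ (hne _ (by omega))
      (fun ζ ↦ C a * X ^ (ℓ + 1) + C b * X ^ ℓ - C ζ) (fun ζ h ↦ ha ?_)
      (fun ζ ↦ by compute_degree) (fun x hx ↦ ?_)
    · simpa [coeff_C, coeff_X_pow] using congrArg (coeff · (ℓ + 1)) h
    · have hpow : x ^ e = x ^ ℓ * x ^ (e - ℓ) := by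
        rw [← pow_add]
        congr 1
        omega
      simp only [IsRoot, eval_sub, eval_add, eval_mul, eval_C, eval_pow, eval_X]
      rw [hpow, hx]
      ring
  · refine card_subtype_le_mul_of_isRoot hd hde _ (hne _ (by omega))
      (fun ζ ↦ C ζ * X ^ m - C a * X - C b) (fun ζ h ↦ hb ?_)
      (fun ζ ↦ by compute_degree; omega) (fun x hx ↦ ?_)
    · simpa [show m ≠ 0 by omega] using congrArg (eval 0) h
    · simp only [IsRoot, eval_sub, eval_mul, eval_C, eval_pow, eval_X]
      rw [← pow_add, hx]
      ring
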